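/- Let Ω = [B₋, B₊] with B₋ < B₊, let a, b : ℝ → ℝ be continuously differentiable with b(x) > 0, a(x) > 0 and c(x) := b(x) − a(x)² < 0 on Ω, and set λ₁(x) := a(x) + √(b(x)) and λ₂(x) := a(x) − √(b(x)) (so that λ₁ > λ₂ > 0 on Ω). Let u : ℝ × [0,∞) → ℝ be twice continuously differentiable and solve the shifted wave equation ∂t(∂t u − a ∂x u) − ∂x(a(∂t u − a ∂x u) + b ∂x u) = 0 on Ω × [0,∞), subject to the two boundary conditions at x = B₊: (∂t u − λ₁ ∂x u)(B₊, t) = g₁(t) and (∂t u − λ₂ ∂x u)(B₊, t) = g₂(t), with no boundary condition at x = B₋. Define E_b(t) := ∫_Ω (∂t u − a ∂x u)² dx + ∫_Ω b (∂x u)² dx, C_{a,b} := max_{x∈Ω}(|a'(x)| + |a'(x) − (a(x)/b(x)) b'(x)|), G(t) := (λ₂(B₊)/2)·g₁(t)² + (λ₁(B₊)/2)·g₂(t)², and BT₂(t) := [(λ₁/2)(∂t u − λ₂ ∂x u)² + (λ₂/2)(∂t u − λ₁ ∂x u)²](B₋, t). Then BT₂(t) ≥ 0 and d/dt E_b(t)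 − C_{a,b} E_b(t) + BT₂(t) ≤ G(t) for all t ≥ 0. -/

import Mathlib

open MeasureTheory

/-- Partial derivative in time of `u : ℝ → ℝ → ℝ` (first argument is space). -/
noncomputable def pdt (u : ℝ → ℝ → ℝ) (x t : ℝ) : ℝ := deriv (fun s => u x s) t

/-- Partial derivative in space of `u : ℝ → ℝ → ℝ` (first argument is space). -/
noncomputable def pdx (u : ℝ → ℝ → ℝ) (x t : ℝ) : ℝ := deriv (fun y => u y t) x

section PartialDerivatives

variable {f : ℝ → ℝ → ℝ}

theorem hasDerivAt_fderiv_time (hf : ContDiff ℝ 1 (fun p : ℝ × ℝ => f p.1 p.2)) (x t : ℝ) :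
    HasDerivAt (fun s => f x s) (fderiv ℝ (fun p : ℝ × ℝ => f p.1 p.2) (x, t) (0, 1)) t :=
  ((hf.differentiable one_ne_zero (x, t)).hasFDerivAt).comp_hasDerivAt t
    ((hasDerivAt_const t x).prodMk (hasDerivAt_id' t))

theorem hasDerivAt_fderiv_space (hf : ContDiff ℝ 1 (fun p : ℝ × ℝ => f p.1 p.2)) (x t : ℝ) :
    HasDerivAt (fun y => f y t) (fderiv ℝ (fun p : ℝ × ℝ => f p.1 p.2) (x, t) (1, 0)) x :=
  ((hf.differentiable one_ne_zero (x, t)).hasFDerivAt).comp_hasDerivAt (f := fun y => (y, t)) x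
    ((hasDerivAt_id' x).prodMk (hasDerivAt_const x t))

theorem pdt_eq_fderiv (hf : ContDiff ℝ 1 (fun p : ℝ × ℝ => f p.1 p.2)) (x t : ℝ) :
    pdt f x t = fderiv ℝ (fun p : ℝ × ℝ => f p.1 p.2) (x, t) (0, 1) :=
  (hasDerivAt_fderiv_time hf x t).deriv

theorem pdx_eq_fderiv (hf : ContDiff ℝ 1 (fun p : ℝ × ℝ => f p.1 p.2)) (x t : ℝ) :
    pdx f x t = fderiv ℝ (fun p : ℝ × ℝ => f p.1 p.2) (x, t) (1, 0) :=
  (hasDerivAt_fderiv_space hf x t).deriv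

theorem hasDerivAt_pdt (hf : ContDiff ℝ 1 (fun p : ℝ × ℝ => f p.1 p.2)) (x t : ℝ) :
    HasDerivAt (fun s => f x s) (pdt f x t) t :=
  (hasDerivAt_fderiv_time hf x t).differentiableAt.hasDerivAt

theorem hasDerivAt_pdx (hf : ContDiff ℝ 1 (fun p : ℝ × ℝ => f p.1 p.2)) (x t : ℝ) :
    HasDerivAt (fun y => f y t) (pdx f x t) x :=
  (hasDerivAt_fderiv_space hf x t).differentiableAt.hasDerivAt

theorem contDiff_pdt {n : WithTop ℕ∞} (hf : ContDiff ℝ (n + 1) (fun p : ℝ × ℝ => f p.1 p.2)) :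
    ContDiff ℝ n (fun p : ℝ × ℝ => pdt f p.1 p.2) := by
  simp only [pdt_eq_fderiv (hf.of_le le_add_self)]
  exact (hf.fderiv_right le_rfl).clm_apply contDiff_const

theorem contDiff_pdx {n : WithTop ℕ∞} (hf : ContDiff ℝ (n + 1) (fun p : ℝ × ℝ => f p.1 p.2)) :
    ContDiff ℝ n (fun p : ℝ × ℝ => pdx f p.1 p.2) := by
  simp only [pdx_eq_fderiv (hf.of_le le_add_self)]
  exact (hf.fderiv_right le_rfl).clm_apply contDiff_const

theorem continuous_pdt (hf : ContDiff ℝ 1 (fun p : ℝ × ℝ => f p.1 p.2)) :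
    Continuous (fun p : ℝ × ℝ => pdt f p.1 p.2) :=
  (contDiff_pdt (n := 0) (by simpa using hf)).continuous

theorem continuous_pdx (hf : ContDiff ℝ 1 (fun p : ℝ × ℝ => f p.1 p.2)) :
    Continuous (fun p : ℝ × ℝ => pdx f p.1 p.2) :=
  (contDiff_pdx (n := 0) (by simpa using hf)).continuous

/-- Symmetry of the mixed second partial derivatives. -/
theorem pdt_pdx_comm (hf : ContDiff ℝ 2 (fun p : ℝ × ℝ => f p.1 p.2)) (x t : ℝ) :
    pdt (pdx f) x t = pdx (pdt f) x t := by
  have hf1 : ContDiff ℝ 1 (fun p : ℝ × ℝ => f p.1 p.2) := hf.of_le one_le_two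
  have hf2 : ContDiff ℝ (1 + 1) (fun p : ℝ × ℝ => f p.1 p.2) := by rwa [one_add_one_eq_two]
  have hd : DifferentiableAt ℝ (fderiv ℝ (fun p : ℝ × ℝ => f p.1 p.2)) (x, t) :=
    (hf2.fderiv_right le_rfl).differentiable one_ne_zero (x, t)
  rw [pdt_eq_fderiv (contDiff_pdx hf2), pdx_eq_fderiv (contDiff_pdt hf2)]
  simp only [pdt_eq_fderiv hf1, pdx_eq_fderiv hf1]
  rw [fderiv_clm_apply hd (differentiableAt_const _), fderiv_clm_apply hd (differentiableAt_const _)]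
  simpa using (hf.contDiffAt.isSymmSndFDerivAt (by simp)) (0, 1) (1, 0)

/-- Differentiation under the integral sign for a `C¹` integrand on a compact interval. -/
theorem hasDerivAt_intervalIntegral_pdt (hf : ContDiff ℝ 1 (fun p : ℝ × ℝ => f p.1 p.2))
    (α β t : ℝ) :
    HasDerivAt (fun s => ∫ x in α..β, f x s) (∫ x in α..β, pdt f x t) t := by
  have hc := continuous_pdt hf
  obtain ⟨M, hM⟩ := (isCompact_uIcc.prod (isCompact_closedBall t 1)).exists_bound_of_continuousOn
    (s := Set.uIcc α β ×ˢ Metric.closedBall t 1) hc.continuousOn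
  have hslice : ∀ s, Continuous fun x => f x s := fun s =>
    hf.continuous.comp (Continuous.prodMk_left s)
  refine (intervalIntegral.hasDerivAt_integral_of_dominated_loc_of_deriv_le
    (F := fun s x => f x s) (F' := fun s x => pdt f x s) (bound := fun _ => M)
    (Metric.closedBall_mem_nhds t one_pos)
    (.of_forall fun s => (hslice s).aestronglyMeasurable)
    ((hslice t).intervalIntegrable _ _)
    (hc.comp (Continuous.prodMk_left t)).aestronglyMeasurable
    (.of_forall fun x hx s hs => hM (x, s) ⟨Set.uIoc_subset_uIcc hx, hs⟩)
    intervalIntegrable_const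
    (.of_forall fun x _ s _ => hasDerivAt_pdt hf x s)).2

end PartialDerivatives

/-- The defining supremum of `C_{a,b}` bounds both coefficients of the zeroth-order terms. -/
theorem le_sSup_coefficients {α β : ℝ} {a b : ℝ → ℝ} (ha : ContDiff ℝ 1 a) (hb : ContDiff ℝ 1 b)
    (hbpos : ∀ x ∈ Set.Icc α β, 0 < b x) {x : ℝ} (hx : x ∈ Set.Icc α β) :
    |deriv a x| + |deriv a x - a x / b x * deriv b x| ≤
      sSup ((fun x => |deriv a x| + |deriv a x - a x / b x * deriv b x|) '' Set.Icc α β) := by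
  have ha' : Continuous (deriv a) := ha.continuous_deriv le_rfl
  have hb' : Continuous (deriv b) := hb.continuous_deriv le_rfl
  have hdiv : ContinuousOn (fun x => a x / b x) (Set.Icc α β) :=
    ha.continuous.continuousOn.div hb.continuous.continuousOn fun x hx => (hbpos x hx).ne'
  refine le_csSup (isCompact_Icc.bddAbove_image ?_) (Set.mem_image_of_mem _ hx)
  exact ha'.continuousOn.abs.add (ha'.continuousOn.sub (hdiv.mul hb'.continuousOn)).abs

/-- The local energy balance: along the system `∂t v = ∂x (a v + b w)`, `∂t w = ∂x (v + a w)`, the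
energy density `v² + b w²` has flux `a v² + 2 b v w + a b w²`, up to zeroth-order terms. -/
theorem pdt_energyDensity_eq {a b : ℝ → ℝ} (ha : ContDiff ℝ 1 a) (hb : ContDiff ℝ 1 b)
    {v w : ℝ → ℝ → ℝ} (hv : ContDiff ℝ 1 (fun p : ℝ × ℝ => v p.1 p.2))
    (hw : ContDiff ℝ 1 (fun p : ℝ × ℝ => w p.1 p.2)) {x t : ℝ}
    (hvt : pdt v x t = pdx (fun y s => a y * v y s + b y * w y s) x t)
    (hwt : pdt w x t = pdx (fun y s => v y s + a y * w y s) x t) :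
    pdt (fun y s => v y s ^ 2 + b y * w y s ^ 2) x t =
      pdx (fun y s => a y * v y s ^ 2 + 2 * b y * v y s * w y s + a y * b y * w y s ^ 2) x t +
        (deriv a x * v x t ^ 2 + (deriv a x * b x - a x * deriv b x) * w x t ^ 2) := by
  have hax := (ha.differentiable one_ne_zero x).hasDerivAt
  have hbx := (hb.differentiable one_ne_zero x).hasDerivAt
  have hvx := hasDerivAt_pdx hv x t
  have hwx := hasDerivAt_pdx hw x t
  have h1 : pdx (fun y s => a y * v y s + b y * w y s) x t = _ :=
    ((hax.mul hvx).add (hbx.mul hwx)).deriv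
  have h2 : pdx (fun y s => v y s + a y * w y s) x t = _ := (hvx.add (hax.mul hwx)).deriv
  have h3 : pdt (fun y s => v y s ^ 2 + b y * w y s ^ 2) x t = _ :=
    (((hasDerivAt_pdt hv x t).pow 2).add (((hasDerivAt_pdt hw x t).pow 2).const_mul (b x))).deriv
  have h4 : pdx (fun y s => a y * v y s ^ 2 + 2 * b y * v y s * w y s + a y * b y * w y s ^ 2) x t
      = _ :=
    (((hax.mul (hvx.pow 2)).add (((hbx.const_mul 2).mul hvx).mul hwx)).add
      ((hax.mul hbx).mul (hwx.pow 2))).deriv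
  rw [h3, h4, hvt, hwt, h1, h2]
  simp only [Pi.mul_apply, Pi.pow_apply]
  push_cast
  ring

/-- boundary stability in the supersonic regime `a > 0`,
`c = b − a² < 0`, with both characteristic boundary conditions imposed at `B₊`:
`BT₂ ≥ 0` and `d/dt E_b − C_{a,b} E_b + BT₂ ≤ G`. -/
theorem ibvp_energy_estimate_supersonic
    (Bm Bp : ℝ) (hB : Bm < Bp)
    (a b : ℝ → ℝ) (ha : ContDiff ℝ 1 a) (hb : ContDiff ℝ 1 b)
    (hbpos : ∀ x ∈ Set.Icc Bm Bp, 0 < b x)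
    (hapos : ∀ x ∈ Set.Icc Bm Bp, 0 < a x)
    (hcneg : ∀ x ∈ Set.Icc Bm Bp, b x - (a x) ^ 2 < 0)
    (u : ℝ → ℝ → ℝ) (hu : ContDiff ℝ 2 (fun p : ℝ × ℝ => u p.1 p.2))
    (hpde : ∀ x ∈ Set.Icc Bm Bp, ∀ t : ℝ, 0 ≤ t →
      deriv (fun s => pdt u x s - a x * pdx u x s) t
        - deriv (fun y => a y * (pdt u y t - a y * pdx u y t) + b y * pdx u y t) x = 0)
    (g₁ g₂ : ℝ → ℝ)
    (hbc1 : ∀ t : ℝ, 0 ≤ t →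
      pdt u Bp t - (a Bp + Real.sqrt (b Bp)) * pdx u Bp t = g₁ t)
    (hbc2 : ∀ t : ℝ, 0 ≤ t →
      pdt u Bp t - (a Bp - Real.sqrt (b Bp)) * pdx u Bp t = g₂ t)
    (E : ℝ → ℝ)
    (hE : E = fun t => (∫ x in Bm..Bp, (pdt u x t - a x * pdx u x t) ^ 2)
        + ∫ x in Bm..Bp, b x * (pdx u x t) ^ 2)
    (C : ℝ)
    (hC : C = sSup ((fun x => |deriv a x| + |deriv a x - a x / b x * deriv b x|) ''
        Set.Icc Bm Bp))
    (G : ℝ → ℝ)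
    (hG : G = fun t => ((a Bp - Real.sqrt (b Bp)) / 2) * (g₁ t) ^ 2
        + ((a Bp + Real.sqrt (b Bp)) / 2) * (g₂ t) ^ 2)
    (BT : ℝ → ℝ)
    (hBT : BT = fun t =>
      ((a Bm + Real.sqrt (b Bm)) / 2)
          * (pdt u Bm t - (a Bm - Real.sqrt (b Bm)) * pdx u Bm t) ^ 2
        + ((a Bm - Real.sqrt (b Bm)) / 2)
          * (pdt u Bm t - (a Bm + Real.sqrt (b Bm)) * pdx u Bm t) ^ 2) :
    ∀ t : ℝ, 0 ≤ t → 0 ≤ BT t ∧ deriv E t - C * E t + BT t ≤ G t := by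
  intro t ht
  have hu2 : ContDiff ℝ (1 + 1) (fun p : ℝ × ℝ => u p.1 p.2) := by rwa [one_add_one_eq_two]
  have ha1 : ContDiff ℝ 1 (fun p : ℝ × ℝ => a p.1) := ha.comp contDiff_fst
  have hb1 : ContDiff ℝ 1 (fun p : ℝ × ℝ => b p.1) := hb.comp contDiff_fst
  have hw : ContDiff ℝ 1 (fun p : ℝ × ℝ => pdx u p.1 p.2) := contDiff_pdx hu2
  have hut : ContDiff ℝ 1 (fun p : ℝ × ℝ => pdt u p.1 p.2) := contDiff_pdt hu2
  obtain ⟨v, hvdef⟩ : ∃ v : ℝ → ℝ → ℝ, v = fun x t => pdt u x t - a x * pdx u x t := ⟨_, rfl⟩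
  have hv : ContDiff ℝ 1 (fun p : ℝ × ℝ => v p.1 p.2) := by
    rw [hvdef]; exact hut.sub (ha1.mul hw)
  have hH : ContDiff ℝ 1 (fun p : ℝ × ℝ => v p.1 p.2 ^ 2 + b p.1 * pdx u p.1 p.2 ^ 2) :=
    (hv.pow 2).add (hb1.mul (hw.pow 2))
  obtain ⟨F, hFdef⟩ : ∃ F : ℝ → ℝ → ℝ, F = fun y s => a y * v y s ^ 2
      + 2 * b y * v y s * pdx u y s + a y * b y * pdx u y s ^ 2 := ⟨_, rfl⟩
  have hF : ContDiff ℝ 1 (fun p : ℝ × ℝ => F p.1 p.2) := by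
    rw [hFdef]
    exact ((ha1.mul (hv.pow 2)).add (((contDiff_const.mul hb1).mul hv).mul hw)).add
      ((ha1.mul hb1).mul (hw.pow 2))
  have hvc : ∀ s, Continuous fun x => v x s := fun s =>
    hv.continuous.comp (Continuous.prodMk_left s)
  have hwc : ∀ s, Continuous fun x => pdx u x s := fun s =>
    hw.continuous.comp (Continuous.prodMk_left s)
  have hE' : E = fun s => ∫ x in Bm..Bp, (v x s ^ 2 + b x * pdx u x s ^ 2) := by
    funext s
    rw [intervalIntegral.integral_add (f := fun x => v x s ^ 2) (g := fun x => b x * pdx u x s ^ 2)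
      (((hvc s).pow 2).intervalIntegrable _ _)
      ((hb.continuous.mul ((hwc s).pow 2)).intervalIntegrable _ _), hE, hvdef]
  have hbalance : ∀ x ∈ Set.Icc Bm Bp,
      pdt (fun y s => v y s ^ 2 + b y * pdx u y s ^ 2) x t =
        pdx F x t +
        (deriv a x * v x t ^ 2 + (deriv a x * b x - a x * deriv b x) * pdx u x t ^ 2) := by
    intro x hx
    rw [hFdef]
    refine pdt_energyDensity_eq ha hb hv hw ?_ ?_
    · rw [hvdef]; exact sub_eq_zero.mp (hpde x hx t ht)
    · rw [pdt_pdx_comm hu, hvdef]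
      congr 1
      funext y s
      ring
  have hRc : Continuous fun x =>
      deriv a x * v x t ^ 2 + (deriv a x * b x - a x * deriv b x) * pdx u x t ^ 2 :=
    ((ha.continuous_deriv le_rfl).mul ((hvc t).pow 2)).add
      ((((ha.continuous_deriv le_rfl).mul hb.continuous).sub
        (ha.continuous.mul (hb.continuous_deriv le_rfl))).mul ((hwc t).pow 2))
  have hFc : IntervalIntegrable (fun x => pdx F x t) volume Bm Bp :=
    ((continuous_pdx hF).comp (Continuous.prodMk_left t)).intervalIntegrable _ _
  have hderiv : deriv E t = F Bp t - F Bm t + ∫ x in Bm..Bp,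
      (deriv a x * v x t ^ 2 + (deriv a x * b x - a x * deriv b x) * pdx u x t ^ 2) := by
    rw [hE', (hasDerivAt_intervalIntegral_pdt
      (f := fun y s => v y s ^ 2 + b y * pdx u y s ^ 2) hH Bm Bp t).deriv,
      intervalIntegral.integral_congr (g := fun x => _ + _)
        (fun x hx => hbalance x (by rwa [Set.uIcc_of_le hB.le] at hx)),
      intervalIntegral.integral_add hFc (hRc.intervalIntegrable _ _),
      intervalIntegral.integral_eq_sub_of_hasDerivAt
        (fun x _ => hasDerivAt_pdx hF x t) hFc]
  have hremainder : ∫ x in Bm..Bp,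
      (deriv a x * v x t ^ 2 + (deriv a x * b x - a x * deriv b x) * pdx u x t ^ 2) ≤ C * E t := by
    simp only [hE']
    rw [← intervalIntegral.integral_const_mul]
    refine intervalIntegral.integral_mono_on hB.le (hRc.intervalIntegrable _ _)
      ((continuous_const.mul (((hvc t).pow 2).add
        (hb.continuous.mul ((hwc t).pow 2)))).intervalIntegrable _ _) fun x hx => ?_
    have hbx := hbpos x hx
    have hCx := le_sSup_coefficients ha hb hbpos hx
    rw [← hC] at hCx
    have h1 : deriv a x ≤ C := by
      linarith [le_abs_self (deriv a x), abs_nonneg (deriv a x - a x / b x * deriv b x)]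
    have h2 : deriv a x - a x / b x * deriv b x ≤ C := by
      linarith [abs_nonneg (deriv a x), le_abs_self (deriv a x - a x / b x * deriv b x)]
    have h3 : deriv a x * b x - a x * deriv b x
        = (deriv a x - a x / b x * deriv b x) * b x := by
      field_simp
    rw [h3]
    calc _ ≤ C * v x t ^ 2 + C * b x * pdx u x t ^ 2 := by gcongr
      _ = _ := by ring
  have hBmem : Bm ∈ Set.Icc Bm Bp := Set.left_mem_Icc.mpr hB.le
  have hsq : ∀ x ∈ Set.Icc Bm Bp, Real.sqrt (b x) ^ 2 = b x := fun x hx =>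
    Real.sq_sqrt (hbpos x hx).le
  constructor
  · have hlt : Real.sqrt (b Bm) < a Bm :=
      (Real.sqrt_lt' (hapos Bm hBmem)).mpr (by linarith [hcneg Bm hBmem])
    have hpos := hapos Bm hBmem
    have hnn := Real.sqrt_nonneg (b Bm)
    rw [hBT]
    have h1 : 0 ≤ (a Bm + Real.sqrt (b Bm)) / 2 := by linarith
    have h2 : 0 ≤ (a Bm - Real.sqrt (b Bm)) / 2 := by linarith
    positivity
  · have hGt : G t = F Bp t := by
      simp only [hFdef]
      rw [← hsq Bp (Set.right_mem_Icc.mpr hB.le), hG, hvdef]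
      simp only [← hbc1 t ht, ← hbc2 t ht]
      ring
    have hBTt : BT t = F Bm t := by
      simp only [hFdef]
      rw [← hsq Bm hBmem, hBT, hvdef]
      ring
    linarith
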